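/- arXiv:2401.06423 — 4 statements merged into one kernel-verified Lean document; each statement's English description precedes it below -/
import Mathlib

section
/- Every point (x, y, z) of the relaxation P̃(G) all of whose coordinates lie in {0,1} satisfies z_{(i,j)} = x_i·y_j for every (i,j) ∈ E; in particular, every integer point of P̃(G) belongs to the integer feasible set S(G). -/
/-- The integer feasible set `S(G)`: all `{0,1}`-valued points `(x, y, z)` with
`z (i,j) = x i * y j` for every edge `(i,j) ∈ E` and `∑_{(i,j) ∈ E} z (i,j) = 1`. -/
def intFeasible {X Y : Type*} [Fintype X] [Fintype Y] (E : Finset (X × Y)) :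
    Set ((X → ℝ) × (Y → ℝ) × (E → ℝ)) :=
  {p | (∀ i, p.1 i = 0 ∨ p.1 i = 1) ∧
       (∀ j, p.2.1 j = 0 ∨ p.2.1 j = 1) ∧
       (∀ e, p.2.2 e = 0 ∨ p.2.2 e = 1) ∧
       (∀ e : E, p.2.2 e = p.1 (e : X × Y).1 * p.2.1 (e : X × Y).2) ∧
       ∑ e : E, p.2.2 e = 1}

/-- The linear relaxation `P̃(G)`: all `[0,1]`-valued points `(x, y, z)` with
`∑_{i ∈ X} x i = 1`, `∑_{j ∈ N(i)} z (i,j) = x i` for every `i ∈ X` and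
`∑_{i ∈ N(j)} z (i,j) = y j` for every `j ∈ Y`. -/
def relaxation {X Y : Type*} [Fintype X] [Fintype Y] [DecidableEq X] [DecidableEq Y]
    (E : Finset (X × Y)) :
    Set ((X → ℝ) × (Y → ℝ) × (E → ℝ)) :=
  {p | (∀ i, p.1 i ∈ Set.Icc (0 : ℝ) 1) ∧
       (∀ j, p.2.1 j ∈ Set.Icc (0 : ℝ) 1) ∧
       (∀ e, p.2.2 e ∈ Set.Icc (0 : ℝ) 1) ∧
       (∑ i, p.1 i = 1) ∧
       (∀ i, ∑ e : E, (if (e : X × Y).1 = i then p.2.2 e else 0) = p.1 i) ∧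
       (∀ j, ∑ e : E, (if (e : X × Y).2 = j then p.2.2 e else 0) = p.2.1 j)}

/-- A `{0,1}`-valued function on a finite type with sum `1` is the indicator of a point. -/
theorem exists_eq_ite_of_sum_eq_one {ι : Type*} [Fintype ι] [DecidableEq ι] {z : ι → ℝ}
    (hz : ∀ e, z e = 0 ∨ z e = 1) (hsum : ∑ e, z e = 1) :
    ∃ e₀, ∀ e, z e = if e = e₀ then 1 else 0 := by
  obtain ⟨e₀, -, h₀⟩ := Finset.exists_ne_zero_of_sum_ne_zero (hsum.trans_ne one_ne_zero)
  have h₁ : z e₀ = 1 := (hz e₀).resolve_left h₀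
  have hnonneg : ∀ e, 0 ≤ z e := fun e => by rcases hz e with h | h <;> simp [h]
  have hrest : ∑ e ∈ Finset.univ.erase e₀, z e = 0 := by
    linarith [Finset.add_sum_erase Finset.univ z (Finset.mem_univ e₀)]
  refine ⟨e₀, fun e => ?_⟩
  split_ifs with h
  · rw [h, h₁]
  · exact (Finset.sum_eq_zero_iff_of_nonneg fun e _ => hnonneg e).1 hrest e (by simp [h])

/-- Every `{0,1}`-valued point of the relaxation `P̃(G)` satisfies the quadratic
constraints `z (i,j) = x i * y j` for every `(i,j) ∈ E`; in particular it
belongs to the integer feasible set `S(G)`. -/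
theorem relaxation_integer_point_mem_intFeasible
    {X Y : Type*} [Fintype X] [Fintype Y] [Nonempty X] [Nonempty Y]
    [DecidableEq X] [DecidableEq Y] (E : Finset (X × Y))
    (x : X → ℝ) (y : Y → ℝ) (z : E → ℝ)
    (hmem : (x, y, z) ∈ relaxation E)
    (hx : ∀ i, x i = 0 ∨ x i = 1)
    (hy : ∀ j, y j = 0 ∨ y j = 1)
    (hz : ∀ e, z e = 0 ∨ z e = 1) :
    (∀ e : E, z e = x (e : X × Y).1 * y (e : X × Y).2) ∧
    (x, y, z) ∈ intFeasible E := by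
  obtain ⟨-, -, -, hx_sum, hzx, hzy⟩ := hmem
  dsimp only at hx_sum hzx hzy
  have hz_sum : ∑ e, z e = 1 := by
    simp_rw [← hx_sum, ← hzx]
    rw [Finset.sum_comm]
    simp
  obtain ⟨e₀, he₀⟩ := exists_eq_ite_of_sum_eq_one hz hz_sum
  have hmul : ∀ e : E, z e = x (e : X × Y).1 * y (e : X × Y).2 := by
    intro e
    have hx₀ : x (e : X × Y).1 = if (e₀ : X × Y).1 = (e : X × Y).1 then 1 else 0 := by
      rw [← hzx, Finset.sum_eq_single e₀ (by simp +contextual [he₀]) (by simp)]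
      simp [he₀]
    have hy₀ : y (e : X × Y).2 = if (e₀ : X × Y).2 = (e : X × Y).2 then 1 else 0 := by
      rw [← hzy, Finset.sum_eq_single e₀ (by simp +contextual [he₀]) (by simp)]
      simp [he₀]
    rw [hx₀, hy₀, he₀]
    simp only [Subtype.ext_iff, Prod.ext_iff, ite_zero_mul_ite_zero, mul_one, eq_comm]
  exact ⟨hmul, hx, hy, hz, hmul, hz_sum⟩
end

section
/- The relaxation P̃(G) is an integral polytope: every extreme point of P̃(G) has all of its coordinates in {0,1}. Equivalently, every point of P̃(G) having at least one coordinate strictly between 0 and 1 is not an extreme point of P̃(G). -/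
/-- The linear map sending an edge weighting `z` to the triple `(x, y, z)` of its marginals on the
two parts together with `z` itself. -/
def edgeMarginals {X Y : Type*} [DecidableEq X] [DecidableEq Y] (E : Finset (X × Y)) :
    (E → ℝ) →ₗ[ℝ] (X → ℝ) × (Y → ℝ) × (E → ℝ) where
  toFun z := (fun i => ∑ e : E, if (e : X × Y).1 = i then z e else 0,
    fun j => ∑ e : E, if (e : X × Y).2 = j then z e else 0, z)
  map_add' z w := by
    refine Prod.ext (funext fun i => ?_) (Prod.ext (funext fun j => ?_) rfl) <;>
    · simp only [Prod.fst_add, Prod.snd_add, Pi.add_apply, ← Finset.sum_add_distrib]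
      refine Finset.sum_congr rfl fun e _ => ?_
      split_ifs <;> simp
  map_smul' c z := by
    refine Prod.ext (funext fun i => ?_) (Prod.ext (funext fun j => ?_) rfl) <;>
      simp [Finset.mul_sum]

theorem sum_ite_ite_eq {ι : Type*} [Fintype ι] [DecidableEq ι] (e : ι) (P : ι → Prop)
    [DecidablePred P] :
    ∑ e', (if P e' then (if e = e' then (1 : ℝ) else 0) else 0) = if P e then 1 else 0 := by
  rw [Finset.sum_eq_single e (fun e' _ h => by simp [h.symm]) (by simp)]
  simp

theorem sum_ite_mem_Icc_of_mem_stdSimplex {ι : Type*} [Fintype ι] {z : ι → ℝ}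
    (hz : z ∈ stdSimplex ℝ ι) (P : ι → Prop) [DecidablePred P] :
    ∑ e, (if P e then z e else 0) ∈ Set.Icc (0 : ℝ) 1 := by
  refine ⟨Finset.sum_nonneg fun e _ => ?_, hz.2 ▸ Finset.sum_le_sum fun e _ => ?_⟩ <;>
    split_ifs <;> simp [hz.1 e]

theorem relaxation_eq_image_stdSimplex {X Y : Type*} [Fintype X] [Fintype Y]
    [DecidableEq X] [DecidableEq Y] (E : Finset (X × Y)) :
    relaxation E = edgeMarginals E '' stdSimplex ℝ E := by
  have sum_fst (z : E → ℝ) :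
      ∑ i, ∑ e : E, (if (e : X × Y).1 = i then z e else 0) = ∑ e, z e := by
    rw [Finset.sum_comm]
    simp
  ext p
  constructor
  · rintro ⟨-, -, hz, hsum, hx, hy⟩
    refine ⟨p.2.2, ⟨fun e => (hz e).1, ?_⟩, Prod.ext (funext hx) (Prod.ext (funext hy) rfl)⟩
    rw [← sum_fst, ← hsum]
    exact Finset.sum_congr rfl fun i _ => hx i
  · rintro ⟨z, hz, rfl⟩
    exact ⟨fun i => sum_ite_mem_Icc_of_mem_stdSimplex hz _,
      fun j => sum_ite_mem_Icc_of_mem_stdSimplex hz _,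
      fun e => mem_Icc_of_mem_stdSimplex hz e,
      (sum_fst z).trans hz.2, fun _ => rfl, fun _ => rfl⟩

/-- The relaxation is the convex hull of the marginals of the single-edge weightings. -/
theorem relaxation_eq_convexHull {X Y : Type*} [Fintype X] [Fintype Y]
    [DecidableEq X] [DecidableEq Y] (E : Finset (X × Y)) :
    relaxation E =
      convexHull ℝ (edgeMarginals E '' Set.range fun e e' : E => if e = e' then (1 : ℝ) else 0) := by
  rw [relaxation_eq_image_stdSimplex, ← convexHull_basis_eq_stdSimplex,
    LinearMap.image_convexHull]

/-- The relaxation `P̃(G)` is an integral polytope: every extreme point of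
`P̃(G)` has all of its coordinates in `{0,1}`. -/
theorem relaxation_extremePoints_integral
    {X Y : Type*} [Fintype X] [Fintype Y] [Nonempty X] [Nonempty Y]
    [DecidableEq X] [DecidableEq Y] (E : Finset (X × Y))
    (p : (X → ℝ) × (Y → ℝ) × (E → ℝ))
    (hp : p ∈ Set.extremePoints ℝ (relaxation E)) :
    (∀ i, p.1 i = 0 ∨ p.1 i = 1) ∧
    (∀ j, p.2.1 j = 0 ∨ p.2.1 j = 1) ∧
    (∀ e, p.2.2 e = 0 ∨ p.2.2 e = 1) := by
  rw [relaxation_eq_convexHull] at hp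
  obtain ⟨_, ⟨e, rfl⟩, rfl⟩ := extremePoints_convexHull_subset hp
  have zero_or_one (P : E → Prop) [DecidablePred P] :
      ∑ e', (if P e' then (if e = e' then (1 : ℝ) else 0) else 0) = 0 ∨
        ∑ e', (if P e' then (if e = e' then (1 : ℝ) else 0) else 0) = 1 := by
    rw [sum_ite_ite_eq]
    exact (ite_eq_or_eq _ _ _).symm
  exact ⟨fun _ => zero_or_one _, fun _ => zero_or_one _, fun _ => (ite_eq_or_eq _ _ _).symm⟩
end

section
/- The linear relaxation is contained in the Boolean quadric polytope with choice constraints: P̃(G) ⊆ P_{X,Y,Z}(G). That is, every point with coordinates in [0,1] satisfying ∑_{i∈X} x_i = 1, ∑_{j∈N(i)} z_{(i,j)} = x_i for every i ∈ X, and ∑_{i∈N(j)} z_{(i,j)} = y_j for every j ∈ Y lies in the convex hull of the {0,1}-points satisfying z_{(i,j)} = x_i·y_j for all (i,j) ∈ E and ∑_{(i,j)∈E} z_{(i,j)} = 1. -/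
/-- The integer point selecting the single edge `e`: the indicators of its two endpoints and of
`e` itself. -/
def edgePoint {X Y : Type*} [DecidableEq X] [DecidableEq Y] {E : Finset (X × Y)} (e : E) :
    (X → ℝ) × (Y → ℝ) × (E → ℝ) :=
  (Pi.single (e : X × Y).1 1, Pi.single (e : X × Y).2 1, Pi.single e 1)

theorem edgePoint_mem_intFeasible {X Y : Type*} [Fintype X] [Fintype Y]
    [DecidableEq X] [DecidableEq Y] {E : Finset (X × Y)} (e : E) :
    edgePoint e ∈ intFeasible E := by
  refine ⟨fun i => ?_, fun j => ?_, fun f => ?_, fun f => ?_, ?_⟩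
  · simp only [edgePoint, Pi.single_apply]
    split_ifs <;> simp
  · simp only [edgePoint, Pi.single_apply]
    split_ifs <;> simp
  · simp only [edgePoint, Pi.single_apply]
    split_ifs <;> simp
  · simp only [edgePoint, Pi.single_apply, Subtype.ext_iff, Prod.ext_iff, ite_and, mul_ite,
      mul_one, mul_zero]
    split_ifs <;> rfl
  · simp [edgePoint]

theorem sum_smul_edgePoint_of_mem_relaxation {X Y : Type*} [Fintype X] [Fintype Y]
    [DecidableEq X] [DecidableEq Y] {E : Finset (X × Y)}
    {p : (X → ℝ) × (Y → ℝ) × (E → ℝ)} (hp : p ∈ relaxation E) :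
    ∑ e : E, p.2.2 e • edgePoint e = p := by
  obtain ⟨-, -, -, -, hx, hy⟩ := hp
  refine Prod.ext (funext fun i => ?_) (Prod.ext (funext fun j => ?_) (funext fun f => ?_))
  · simp [edgePoint, Prod.fst_sum, Finset.sum_apply, Pi.single_apply, ← hx i, eq_comm]
  · simp [edgePoint, Prod.fst_sum, Prod.snd_sum, Finset.sum_apply, Pi.single_apply, ← hy j,
      eq_comm]
  · simp [edgePoint, Prod.snd_sum, Finset.sum_apply, Pi.single_apply]

theorem sum_edges_eq_one_of_mem_relaxation {X Y : Type*} [Fintype X] [Fintype Y]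
    [DecidableEq X] [DecidableEq Y] {E : Finset (X × Y)}
    {p : (X → ℝ) × (Y → ℝ) × (E → ℝ)} (hp : p ∈ relaxation E) :
    ∑ e : E, p.2.2 e = 1 := by
  obtain ⟨-, -, -, hsum, hx, -⟩ := hp
  rw [← hsum, ← Finset.sum_congr rfl fun i _ => hx i, Finset.sum_comm]
  simp

/-- The linear relaxation is contained in the Boolean quadric polytope with
choice constraints: `P̃(G) ⊆ P_{X,Y,Z}(G)`. -/
theorem relaxation_subset_convexHull_intFeasible
    {X Y : Type*} [Fintype X] [Fintype Y] [Nonempty X] [Nonempty Y]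
    [DecidableEq X] [DecidableEq Y] (E : Finset (X × Y)) :
    relaxation E ⊆ convexHull ℝ (intFeasible E) := by
  intro p hp
  rw [← sum_smul_edgePoint_of_mem_relaxation hp]
  exact (convex_convexHull ℝ _).sum_mem (fun e _ => (hp.2.2.1 e).1)
    (sum_edges_eq_one_of_mem_relaxation hp)
    fun e _ => subset_convexHull ℝ _ (edgePoint_mem_intFeasible e)
end

section
/- Let (x, y, z) be a point of the relaxation P̃(G) such that some coordinate x_i with i ∈ X is strictly between 0 and 1. Then there exist an index k ∈ X with k ≠ i such that x_k is strictly between 0 and 1, an edge (i,j) ∈ E with z_{(i,j)} strictly between 0 and 1, and an edge (k,l) ∈ E with z_{(k,l)} strictly between 0 and 1; moreover y_j > 0 and y_l > 0. -/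
/-- In a point of the relaxation, a vertex `i` with `0 < x i < 1` is incident to an edge `(i, j)`
with `0 < z (i,j) < 1` and `0 < y j`. -/
lemma exists_fractional_edge_of_mem_relaxation
    {X Y : Type*} [Fintype X] [Fintype Y] [DecidableEq X] [DecidableEq Y] {E : Finset (X × Y)}
    {x : X → ℝ} {y : Y → ℝ} {z : E → ℝ} (hmem : (x, y, z) ∈ relaxation E)
    {i : X} (hpos : 0 < x i) (hlt : x i < 1) :
    ∃ (j : Y) (hij : (i, j) ∈ E),
      (0 < z ⟨(i, j), hij⟩ ∧ z ⟨(i, j), hij⟩ < 1) ∧ 0 < y j := by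
  obtain ⟨-, -, hz, -, hX, hY⟩ := hmem
  dsimp only at hz hX hY
  rw [← hX i] at hpos
  obtain ⟨⟨⟨a, j⟩, he⟩, -, hzpos⟩ :=
    Finset.exists_lt_of_sum_lt (f := fun _ ↦ (0 : ℝ)) (by simpa using hpos)
  obtain rfl : a = i := by
    by_contra h
    simp [h] at hzpos
  simp only [if_true] at hzpos
  have hle_x : z ⟨(a, j), he⟩ ≤ x a := by
    rw [← hX a]
    simpa using Finset.single_le_sum
      (f := fun e : E ↦ if (e : X × Y).1 = a then z e else 0)
      (fun e _ ↦ ite_nonneg (hz e).1 le_rfl) (Finset.mem_univ ⟨(a, j), he⟩)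
  have hle_y : z ⟨(a, j), he⟩ ≤ y j := by
    rw [← hY j]
    simpa using Finset.single_le_sum
      (f := fun e : E ↦ if (e : X × Y).2 = j then z e else 0)
      (fun e _ ↦ ite_nonneg (hz e).1 le_rfl) (Finset.mem_univ ⟨(a, j), he⟩)
  exact ⟨j, he, ⟨hzpos, hle_x.trans_lt hlt⟩, hzpos.trans_le hle_y⟩

/-- If a point of the relaxation `P̃(G)` has a coordinate `x i` strictly between
`0` and `1`, then there is another index `k ≠ i` with `x k` strictly between `0`
and `1`, an edge `(i,j) ∈ E` with `z (i,j)` strictly between `0` and `1`, and an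
edge `(k,l) ∈ E` with `z (k,l)` strictly between `0` and `1`; moreover `y j > 0`
and `y l > 0`. -/
theorem relaxation_fractional_structure
    {X Y : Type*} [Fintype X] [Fintype Y] [Nonempty X] [Nonempty Y]
    [DecidableEq X] [DecidableEq Y] (E : Finset (X × Y))
    (x : X → ℝ) (y : Y → ℝ) (z : E → ℝ)
    (hmem : (x, y, z) ∈ relaxation E)
    (i : X) (hxi : 0 < x i ∧ x i < 1) :
    ∃ k : X, k ≠ i ∧ (0 < x k ∧ x k < 1) ∧
      ∃ (j : Y) (hij : (i, j) ∈ E) (l : Y) (hkl : (k, l) ∈ E),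
        (0 < z ⟨(i, j), hij⟩ ∧ z ⟨(i, j), hij⟩ < 1) ∧
        (0 < z ⟨(k, l), hkl⟩ ∧ z ⟨(k, l), hkl⟩ < 1) ∧
        0 < y j ∧ 0 < y l := by
  obtain ⟨hx, -, -, hsum, -, -⟩ := id hmem
  dsimp only at hx hsum
  have hsplit : x i + ∑ k ∈ Finset.univ.erase i, x k = 1 := by
    rw [Finset.add_sum_erase _ _ (Finset.mem_univ i), hsum]
  obtain ⟨k, hk, hkpos⟩ : ∃ k ∈ Finset.univ.erase i, 0 < x k :=
    Finset.exists_lt_of_sum_lt (f := fun _ ↦ (0 : ℝ))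
      (by rw [Finset.sum_const_zero]; linarith [hxi.2])
  have hkle : x k ≤ ∑ k ∈ Finset.univ.erase i, x k :=
    Finset.single_le_sum (fun m _ ↦ (hx m).1) hk
  have hklt : x k < 1 := by linarith [hxi.1]
  obtain ⟨j, hij, hzij, hyj⟩ := exists_fractional_edge_of_mem_relaxation hmem hxi.1 hxi.2
  obtain ⟨l, hkl, hzkl, hyl⟩ := exists_fractional_edge_of_mem_relaxation hmem hkpos hklt
  exact ⟨k, Finset.ne_of_mem_erase hk, ⟨hkpos, hklt⟩, j, hij, l, hkl, hzij, hzkl, hyj, hyl⟩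
end
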